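/- arXiv:1302.1677 — 3 statements merged into one kernel-verified Lean document; each statement's English description precedes it below -/
import Mathlib

section
/- Assume g ≥ α for some constant α > 0 and that Ω is a bounded domain satisfying a uniform inner cone condition. Then there exists a constant C > 0 (depending only on Ω, g, J, b) such that every positive continuous solution u of the nonlocal equation satisfies sup_Ω u ≤ C·inf_Ω u. -/
open MeasureTheory Metric Set
open scoped RealInnerProductSpace

/-- Harnack for a class of functions satisfying local averaging bounds. -/
theorem harnack_aux {d : ℕ} (Ω : Set (EuclideanSpace ℝ (Fin d))) (hΩopen : IsOpen Ω)
    (hΩconn : IsConnected Ω) (t : Finset (EuclideanSpace ℝ (Fin d))) (δ k₁ k₂ : ℝ)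
    (hδ : 0 < δ) (hk₁ : 0 < k₁) (hk₂ : 0 < k₂)
    (htΩ : ∀ x ∈ t, x ∈ Ω) (hcov : ∀ y ∈ Ω, ∃ x ∈ t, dist y x < δ / 4)
    (S : (EuclideanSpace ℝ (Fin d) → ℝ) → Prop)
    (hint : ∀ u, S u → IntegrableOn u Ω) (hpos : ∀ u, S u → ∀ x ∈ Ω, 0 < u x)
    (hlo : ∀ u, S u → ∀ x ∈ Ω, k₁ * (∫ y in Ω ∩ ball x δ, u y) ≤ u x)
    (hup : ∀ u, S u → ∀ x ∈ Ω, u x ≤ k₂ * ∫ y in Ω, u y) :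
    ∃ C : ℝ, 0 < C ∧ ∀ u, S u → ∀ x ∈ Ω, ∀ y ∈ Ω, u x ≤ C * u y := by
  have hInn : ∀ u, S u → ∀ x, 0 ≤ ∫ y in Ω ∩ ball x (δ/4), u y := fun u hu x =>
    setIntegral_nonneg (hΩopen.inter isOpen_ball).measurableSet
      fun y hy => (hpos u hu y hy.1).le
  have hlo' : ∀ u, S u → ∀ x, ∀ w ∈ Ω, dist w x < δ / 2 →
      k₁ * (∫ y in Ω ∩ ball x (δ/4), u y) ≤ u w := by
    intro u hu x w hw hd
    refine le_trans (mul_le_mul_of_nonneg_left ?_ hk₁.le) (hlo u hu w hw)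
    apply setIntegral_mono_set ((hint u hu).mono_set inter_subset_left)
    · exact (ae_restrict_iff' (hΩopen.inter isOpen_ball).measurableSet).2
        (Filter.Eventually.of_forall fun y hy => (hpos u hu y hy.1).le)
    · apply Filter.Eventually.of_forall
      rintro y ⟨hy1, hy2⟩
      refine ⟨hy1, ?_⟩
      have h1 : dist y x < δ / 4 := hy2
      have := dist_triangle_right y w x
      show dist y w < δ
      linarith
  have hstep : ∀ x y, x ∈ Ω → y ∈ Ω → dist x y < δ / 4 → ∃ C : ℝ, 0 < C ∧ ∀ u, S u →
      (∫ z in Ω ∩ ball x (δ/4), u z) ≤ C * ∫ z in Ω ∩ ball y (δ/4), u z := by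
    intro x y hx hy hxy
    have ho : IsOpen (Ω ∩ ball y (δ/4)) := hΩopen.inter isOpen_ball
    have hfin : volume (Ω ∩ ball y (δ/4)) ≠ ⊤ :=
      ((measure_mono inter_subset_right).trans_lt measure_ball_lt_top).ne
    have hv : 0 < (volume (Ω ∩ ball y (δ/4))).toReal :=
      ENNReal.toReal_pos (ho.measure_pos volume ⟨y, hy, mem_ball_self (by linarith)⟩).ne' hfin
    set v := (volume (Ω ∩ ball y (δ/4))).toReal with hvdef
    refine ⟨(v * k₁)⁻¹, by positivity, fun u hu => ?_⟩
    rw [inv_mul_eq_div, le_div_iff₀ (by positivity)]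
    have : ∫ z in Ω ∩ ball y (δ/4), (k₁ * ∫ z in Ω ∩ ball x (δ/4), u z)
        ≤ ∫ z in Ω ∩ ball y (δ/4), u z := by
      refine setIntegral_mono_on (integrableOn_const hfin)
        ((hint u hu).mono_set inter_subset_left) ho.measurableSet ?_
      rintro z ⟨hz1, hz2⟩
      apply hlo' u hu x z hz1
      have h1 : dist z y < δ / 4 := hz2
      have := dist_triangle_right z x y
      linarith
    rw [setIntegral_const, smul_eq_mul, Measure.real, ← hvdef] at this
    linarith
  have hall : ∀ x ∈ Ω, ∀ y ∈ Ω, ∃ C : ℝ, 0 < C ∧ ∀ u, S u →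
      (∫ z in Ω ∩ ball x (δ/4), u z) ≤ C * ∫ z in Ω ∩ ball y (δ/4), u z := by
    intro x hx y hy
    refine hΩconn.isPreconnected.induction₂' (fun x y => ∃ C : ℝ, 0 < C ∧ ∀ u, S u →
      (∫ z in Ω ∩ ball x (δ/4), u z) ≤ C * ∫ z in Ω ∩ ball y (δ/4), u z) ?_ ?_ hx hy
    · intro x hx
      filter_upwards [self_mem_nhdsWithin,
        mem_nhdsWithin_of_mem_nhds (ball_mem_nhds x (show 0 < δ/4 by linarith))] with y hy hb
      exact ⟨hstep x y hx hy (by rw [dist_comm]; exact hb), hstep y x hy hx hb⟩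
    · rintro x y z hx hy hz ⟨C, hC, h⟩ ⟨D, hD, h'⟩
      refine ⟨C * D, by positivity, fun u hu => (h u hu).trans ?_⟩
      rw [mul_assoc]
      exact mul_le_mul_of_nonneg_left (h' u hu) hC.le
  choose! C hCpos hC using hall
  have hKnn : ∀ i ∈ t, ∀ j ∈ t, C i j ≤ ∑ i ∈ t, ∑ j ∈ t, C i j := by
    intro i hi j hj
    calc C i j ≤ ∑ j ∈ t, C i j := Finset.single_le_sum (f := fun j => C i j)
          (fun j hj => (hCpos i (htΩ i hi) j (htΩ j hj)).le) hj
      _ ≤ _ := Finset.single_le_sum (f := fun i => ∑ j ∈ t, C i j)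
          (fun i hi => Finset.sum_nonneg
            fun j hj => (hCpos i (htΩ i hi) j (htΩ j hj)).le) hi
  set K := ∑ i ∈ t, ∑ j ∈ t, C i j with hK
  obtain ⟨x₀, hx₀⟩ := hΩconn.nonempty
  obtain ⟨i₀, hi₀, -⟩ := hcov x₀ hx₀
  have hKpos : 0 < K := lt_of_lt_of_le (hCpos i₀ (htΩ _ hi₀) i₀ (htΩ _ hi₀)) (hKnn i₀ hi₀ i₀ hi₀)
  have hcard : 0 < (t.card : ℝ) := by exact_mod_cast Finset.card_pos.2 ⟨i₀, hi₀⟩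
  refine ⟨k₂ * (t.card * (K * k₁⁻¹)), by positivity, fun u hu x hx y hy => ?_⟩
  rw [mul_assoc]
  refine (hup u hu x hx).trans (mul_le_mul_of_nonneg_left ?_ hk₂.le)
  obtain ⟨j, hj, hyj⟩ := hcov y hy
  have h1 : ∀ i ∈ t, (∫ z in Ω ∩ ball i (δ/4), u z) ≤ K * k₁⁻¹ * u y := by
    intro i hi
    refine (hC i (htΩ i hi) j (htΩ j hj) u hu).trans ?_
    refine (mul_le_mul_of_nonneg_right (hKnn i hi j hj) (hInn u hu j)).trans ?_
    rw [mul_assoc]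
    refine mul_le_mul_of_nonneg_left ?_ hKpos.le
    rw [inv_mul_eq_div, le_div_iff₀ hk₁, mul_comm]
    exact hlo' u hu j y hy (by linarith)
  calc (∫ z in Ω, u z) ≤ ∫ z in Ω, ∑ i ∈ t, (ball i (δ/4)).indicator u z := by
        refine setIntegral_mono_on (hint u hu) ?_ hΩopen.measurableSet ?_
        · exact integrable_finsetSum _ fun i _ => (hint u hu).indicator measurableSet_ball
        · intro z hz
          obtain ⟨i, hi, hzi⟩ := hcov z hz
          have : u z = (ball i (δ/4)).indicator u z := (indicator_of_mem (mem_ball.2 hzi) u).symm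
          rw [this]
          exact Finset.single_le_sum (f := fun i => (ball i (δ/4)).indicator u z)
            (fun k _ => indicator_apply_nonneg fun _ => (hpos u hu z hz).le) hi
    _ = ∑ i ∈ t, ∫ z in Ω ∩ ball i (δ/4), u z := by
        rw [integral_finsetSum _ fun i _ => (hint u hu).indicator measurableSet_ball]
        exact Finset.sum_congr rfl fun i _ => setIntegral_indicator measurableSet_ball
    _ ≤ ∑ i ∈ t, K * k₁⁻¹ * u y := Finset.sum_le_sum h1
    _ = _ := by rw [Finset.sum_const, nsmul_eq_mul]; ring

/-- Corollary 1.7 (`h-cor2`): if `g ≥ α > 0` and `Ω` is a bounded domain satisfying a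
uniform inner cone condition, then `sup_Ω u ≤ C inf_Ω u` for every positive continuous
solution `u` of the nonlocal equation. -/
theorem stmt_4 {d : ℕ} (hd : 0 < d)
    (Ω : Set (EuclideanSpace ℝ (Fin d))) (hΩopen : IsOpen Ω) (hΩconn : IsConnected Ω)
    (hΩbd : Bornology.IsBounded Ω)
    (J g b : EuclideanSpace ℝ (Fin d) → ℝ)
    (m₀ M₀ r₀ α β : ℝ)
    (hm₀ : 0 < m₀) (hM₀ : 0 < M₀) (hr₀ : 0 < r₀) (hr₀le : r₀ ≤ 1) (hα : 0 < α) (hβ : 0 < β)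
    -- (H1) J ∈ L¹ ∩ L^∞
    (hJ1 : Integrable J) (hJbd : ∃ M, ∀ x, |J x| ≤ M)
    -- (H2)
    (hJ2 : ∀ x, (Metric.ball (0 : EuclideanSpace ℝ (Fin d)) r₀).indicator (fun _ => m₀) x ≤ J x ∧
                J x ≤ (Metric.ball (0 : EuclideanSpace ℝ (Fin d)) 1).indicator (fun _ => M₀) x)
    -- (H3) with the lower bound g ≥ α > 0
    (hg : ∀ x ∈ Ω, α ≤ g x ∧ g x ≤ β)
    -- (H4)
    (hb : ContinuousOn b (closure Ω)) (hbpos : ∀ x ∈ closure Ω, 0 < b x)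
    -- Ω satisfies a uniform inner cone condition
    (hcone : ∃ θ ∈ Set.Ioo (0 : ℝ) (Real.pi / 2), ∃ a > (0 : ℝ), ∀ x ∈ Ω,
        ∃ e : EuclideanSpace ℝ (Fin d), ‖e‖ = 1 ∧
          {y | 0 < ‖y - x‖ ∧ ‖y - x‖ ≤ a ∧ ‖y - x‖ * Real.cos θ ≤ ⟪y - x, e⟫} ⊆ Ω) :
    ∃ C : ℝ, 0 < C ∧
      ∀ u : EuclideanSpace ℝ (Fin d) → ℝ,
        ContinuousOn u Ω → (∀ x ∈ Ω, 0 < u x) →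
        (∀ x ∈ Ω, b x * u x = ∫ y in Ω, J ((g y)⁻¹ • (x - y)) * u y / g y ^ d) →
        ∀ x ∈ Ω, ∀ y ∈ Ω, u x ≤ C * u y := by
  obtain ⟨B, hB0, hB⟩ : ∃ B, 0 < B ∧ ∀ x ∈ Ω, b x ≤ B := by
    obtain ⟨z, hz, h⟩ := hΩbd.isCompact_closure.exists_isMaxOn hΩconn.nonempty.closure hb
    exact ⟨b z, hbpos z hz, fun x hx => h (subset_closure hx)⟩
  obtain ⟨A, hA0, hA⟩ : ∃ A, 0 < A ∧ ∀ x ∈ Ω, A ≤ b x := by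
    obtain ⟨z, hz, h⟩ := hΩbd.isCompact_closure.exists_isMinOn hΩconn.nonempty.closure hb
    exact ⟨b z, hbpos z hz, fun x hx => h (subset_closure hx)⟩
  have hδ : 0 < r₀ * α := by positivity
  have hδ4 : 0 < r₀ * α / 4 := by positivity
  obtain ⟨t, htΩ, hcov⟩ : ∃ t : Finset (EuclideanSpace ℝ (Fin d)), (∀ x ∈ t, x ∈ Ω) ∧
      ∀ y ∈ Ω, ∃ x ∈ t, dist y x < r₀ * α / 4 := by
    have htb : TotallyBounded Ω := hΩbd.isCompact_closure.totallyBounded.subset subset_closure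
    obtain ⟨t, hts, htf, hc⟩ := finite_approx_of_totallyBounded htb _ hδ4
    refine ⟨htf.toFinset, fun x hx => hts (htf.mem_toFinset.1 hx), fun y hy => ?_⟩
    obtain ⟨x, hx, hxy⟩ := mem_iUnion₂.1 (hc hy)
    exact ⟨x, htf.mem_toFinset.2 hx, hxy⟩
  have hJ0 : ∀ x, 0 ≤ J x := fun x =>
    le_trans (indicator_apply_nonneg fun _ => hm₀.le) (hJ2 x).1
  have hJM : ∀ x, J x ≤ M₀ := fun x =>
    (hJ2 x).2.trans (indicator_apply_le' (fun _ => le_rfl) fun _ => hM₀.le)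
  have hJm : ∀ x ∈ Ω, ∀ y ∈ Ω, dist y x < r₀ * α → m₀ ≤ J ((g y)⁻¹ • (x - y)) := by
    intro x _ y hy hd
    have hgy := (hg y hy).1
    have hgp : 0 < g y := hα.trans_le hgy
    have := (hJ2 ((g y)⁻¹ • (x - y))).1
    rwa [indicator_of_mem] at this
    rw [mem_ball_zero_iff, norm_smul, norm_inv, Real.norm_of_nonneg hgp.le,
      inv_mul_eq_div, div_lt_iff₀ hgp, ← dist_eq_norm, dist_comm]
    exact hd.trans_le (mul_le_mul_of_nonneg_left hgy hr₀.le)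
  let S : (EuclideanSpace ℝ (Fin d) → ℝ) → Prop := fun u =>
    ContinuousOn u Ω ∧ (∀ x ∈ Ω, 0 < u x) ∧
      (∀ x ∈ Ω, b x * u x = ∫ y in Ω, J ((g y)⁻¹ • (x - y)) * u y / g y ^ d)
  have hF : ∀ u, S u → ∀ x ∈ Ω,
      IntegrableOn (fun y => J ((g y)⁻¹ • (x - y)) * u y / g y ^ d) Ω := by
    rintro u ⟨_, hp, he⟩ x hx
    by_contra hn
    have h := he x hx
    rw [integral_undef hn] at h
    exact (mul_pos (hA0.trans_le (hA x hx)) (hp x hx)).ne' h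
  have hlow : ∀ u, S u → ∀ x ∈ Ω, ∀ y ∈ Ω ∩ ball x (r₀ * α),
      m₀ / β ^ d * u y ≤ J ((g y)⁻¹ • (x - y)) * u y / g y ^ d := by
    rintro u ⟨_, hp, he⟩ x hx y ⟨hy, hyb⟩
    have hgp : 0 < g y := hα.trans_le (hg y hy).1
    have hup := hp y hy
    rw [div_mul_eq_mul_div]
    have := hJm x hx y hy hyb
    have h2 : g y ^ d ≤ β ^ d := pow_le_pow_left₀ hgp.le (hg y hy).2 d
    have := hJ0 ((g y)⁻¹ • (x - y))
    gcongr
  have hloc : ∀ u, S u → ∀ x ∈ Ω, IntegrableOn u (Ω ∩ ball x (r₀ * α)) := by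
    intro u hu x hx
    have hc : 0 < m₀ / β ^ d := by positivity
    have hm : MeasurableSet (Ω ∩ ball x (r₀ * α)) := (hΩopen.inter isOpen_ball).measurableSet
    have h1 := (((hF u hu x hx).mono_set (inter_subset_left (t := ball x (r₀ * α)))).const_mul
      (m₀ / β ^ d)⁻¹)
    refine Integrable.mono' h1 ((hu.1.mono inter_subset_left).aestronglyMeasurable hm) ?_
    refine (ae_restrict_iff' hm).2 (Filter.Eventually.of_forall fun y hy => ?_)
    rw [Real.norm_of_nonneg (hu.2.1 y hy.1).le, inv_mul_eq_div, le_div_iff₀ hc, mul_comm]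
    exact hlow u hu x hx y hy
  have hint : ∀ u, S u → IntegrableOn u Ω := by
    intro u hu
    have : IntegrableOn u (⋃ x ∈ t, Ω ∩ ball x (r₀ * α)) :=
      integrableOn_finset_iUnion.2 fun x hx => hloc u hu x (htΩ x hx)
    refine this.mono_set fun y hy => ?_
    obtain ⟨x, hx, hxy⟩ := hcov y hy
    exact mem_iUnion₂.2 ⟨x, hx, hy, show dist y x < _ by linarith⟩
  obtain ⟨C, hC, h⟩ := harnack_aux Ω hΩopen hΩconn t (r₀ * α) (m₀ / β ^ d / B) (M₀ / α ^ d / A)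
    hδ (by positivity) (by positivity) htΩ hcov S hint (fun u hu => hu.2.1) (by
      intro u hu x hx
      have hm : MeasurableSet (Ω ∩ ball x (r₀ * α)) := (hΩopen.inter isOpen_ball).measurableSet
      have h1 : ∫ y in Ω ∩ ball x (r₀ * α), m₀ / β ^ d * u y ≤ b x * u x := by
        rw [hu.2.2 x hx]
        refine (setIntegral_mono_on ((hloc u hu x hx).const_mul _)
          ((hF u hu x hx).mono_set inter_subset_left) hm (hlow u hu x hx)).trans ?_
        refine setIntegral_mono_set (hF u hu x hx) ?_
          (Filter.Eventually.of_forall fun y hy => hy.1)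
        refine (ae_restrict_iff' hΩopen.measurableSet).2 (Filter.Eventually.of_forall fun y hy => ?_)
        have hgp : 0 < g y := hα.trans_le (hg y hy).1
        exact div_nonneg (mul_nonneg (hJ0 _) (hu.2.1 y hy).le) (by positivity)
      rw [integral_const_mul] at h1
      rw [div_mul_eq_mul_div, div_le_iff₀ hB0, mul_comm (u x)]
      exact h1.trans (mul_le_mul_of_nonneg_right (hB x hx) (hu.2.1 x hx).le)) (by
      intro u hu x hx
      have h1 : b x * u x ≤ ∫ y in Ω, M₀ / α ^ d * u y := by
        rw [hu.2.2 x hx]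
        refine setIntegral_mono_on (hF u hu x hx) ((hint u hu).const_mul _)
          hΩopen.measurableSet fun y hy => ?_
        have hgp : 0 < g y := hα.trans_le (hg y hy).1
        have hup := hu.2.1 y hy
        rw [div_mul_eq_mul_div]
        have h2 : α ^ d ≤ g y ^ d := pow_le_pow_left₀ hα.le (hg y hy).1 d
        have := hJM ((g y)⁻¹ • (x - y))
        gcongr
      rw [integral_const_mul] at h1
      rw [div_mul_eq_mul_div, le_div_iff₀ hA0, mul_comm (u x)]
      exact (mul_le_mul_of_nonneg_right (hA x hx) (hu.2.1 x hx).le).trans h1)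
  exact ⟨C, hC, fun u h1 h2 h3 => h u ⟨h1, h2, h3⟩⟩
end

section
/- Let Ω ⊆ ℝ^d be a domain, Σ a connected compact set compactly contained in Ω, and C₀ > 0. Choose η > 0 such that ⋃_{x∈Σ} B(x,4η) is compactly contained in Ω, and define X̃ := {u ∈ C(Ω) : u ≥ 0 and u(y) ≥ C₀·∫_{B(y,η)} u(s) ds for all y ∈ ⋃_{x∈Σ} B(x,2η)}. Then there exists a constant C > 0 (depending only on η, C₀, Σ) such that for all x, y ∈ Σ and all u ∈ X̃: ∫_{B(x,η/4)} u(s) ds ≥ C·∫_{B(y,η/4)} u(s) ds. -/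
open MeasureTheory Metric Set

theorem chain_aux {E ι : Type*} [PseudoMetricSpace E] (S : Set E) (hc : IsCompact S)
    (hconn : IsConnected S) (I : ι → E → ℝ) (hI : ∀ i, ∀ x ∈ S, 0 ≤ I i x)
    (k r : ℝ) (hk : 0 < k) (hr : 0 < r)
    (h : ∀ x ∈ S, ∀ y ∈ S, dist x y < r → ∀ i, k * I i y ≤ I i x) :
    ∃ C : ℝ, 0 < C ∧ ∀ x ∈ S, ∀ y ∈ S, ∀ i, C * I i y ≤ I i x := by
  have hR : ∀ x ∈ S, ∀ y ∈ S, ∃ C : ℝ, 0 < C ∧ ∀ i, C * I i y ≤ I i x := by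
    intro x hx y hy
    refine hconn.isPreconnected.induction₂' (fun x y => ∃ C : ℝ, 0 < C ∧ ∀ i, C * I i y ≤ I i x)
      ?_ ?_ hx hy
    · intro x hx
      filter_upwards [self_mem_nhdsWithin, mem_nhdsWithin_of_mem_nhds (ball_mem_nhds x hr)]
        with y hy hyx
      exact ⟨⟨k, hk, h x hx y hy (by rw [dist_comm]; exact hyx)⟩, ⟨k, hk, h y hy x hx hyx⟩⟩
    · rintro x y z hx hy hz ⟨C, hC, h1⟩ ⟨D, hD, h2⟩
      refine ⟨C * D, mul_pos hC hD, fun i => ?_⟩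
      have := mul_le_mul_of_nonneg_left (h2 i) hC.le
      rw [mul_assoc]; exact this.trans (h1 i)
  obtain ⟨x0, hx0⟩ := hconn.nonempty
  have hU : ∃ C : ℝ, 0 < C ∧ ∀ x ∈ S, x ∈ S → ∀ i, C * I i x0 ≤ I i x ∧ C * I i x ≤ I i x0 := by
    refine hc.induction_on (p := fun s => ∃ C : ℝ, 0 < C ∧ ∀ x ∈ s, x ∈ S → ∀ i,
      C * I i x0 ≤ I i x ∧ C * I i x ≤ I i x0) ⟨1, one_pos, by simp⟩ ?_ ?_ ?_
    · rintro s t hst ⟨C, hC, h1⟩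
      exact ⟨C, hC, fun x hx => h1 x (hst hx)⟩
    · rintro s t ⟨C, hC, h1⟩ ⟨D, hD, h2⟩
      refine ⟨min C D, lt_min hC hD, ?_⟩
      intro x hx hxS i
      have a := mul_le_mul_of_nonneg_right (min_le_left C D) (hI i x0 hx0)
      have b := mul_le_mul_of_nonneg_right (min_le_right C D) (hI i x0 hx0)
      have a' := mul_le_mul_of_nonneg_right (min_le_left C D) (hI i x hxS)
      have b' := mul_le_mul_of_nonneg_right (min_le_right C D) (hI i x hxS)
      rcases hx with hx | hx
      · exact ⟨a.trans (h1 x hx hxS i).1, a'.trans (h1 x hx hxS i).2⟩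
      · exact ⟨b.trans (h2 x hx hxS i).1, b'.trans (h2 x hx hxS i).2⟩
    · intro x hx
      refine ⟨ball x r, mem_nhdsWithin_of_mem_nhds (ball_mem_nhds x hr), ?_⟩
      obtain ⟨C, hC, h1⟩ := hR x hx x0 hx0
      obtain ⟨D, hD, h2⟩ := hR x0 hx0 x hx
      have hm : 0 < min C D := lt_min hC hD
      refine ⟨k * min C D, mul_pos hk hm, ?_⟩
      intro y hy hyS i
      have e1 := h y hyS x hx hy i
      have e2 := h x hx y hyS (by rw [dist_comm]; exact hy) i
      have a := mul_le_mul_of_nonneg_right (min_le_left C D) (hI i x0 hx0)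
      have b := mul_le_mul_of_nonneg_right (min_le_right C D) (hI i x hx)
      constructor
      · have := mul_le_mul_of_nonneg_left (a.trans (h1 i)) hk.le
        rw [mul_assoc]; exact this.trans e1
      · have := mul_le_mul_of_nonneg_left e2 hm.le
        have h3 := h2 i
        calc k * min C D * I i y = min C D * (k * I i y) := by ring
          _ ≤ _ := this
          _ ≤ _ := b
          _ ≤ _ := h3
  obtain ⟨C, hC, hU⟩ := hU
  refine ⟨C * C, mul_pos hC hC, fun x hx y hy i => ?_⟩
  have := mul_le_mul_of_nonneg_left (hU y hy hy i).2 hC.le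
  rw [mul_assoc]; exact this.trans (hU x hx hx i).1

/-- Lemma 3.2 (i) (`h-lem-loc-esti3` (i)): for a connected compact `Sg ⊂⊂ Ω` and `η > 0`
with `⋃_{x∈Sg} B(x,4η) ⊂⊂ Ω`, there is `C > 0` such that every `u ∈ X̃` satisfies
`∫_{B(x,η/4)} u ≥ C ∫_{B(y,η/4)} u` for all `x, y ∈ Sg`. -/
theorem stmt_9 {d : ℕ} (hd : 0 < d)
    (Ω : Set (EuclideanSpace ℝ (Fin d))) (hΩopen : IsOpen Ω) (hΩconn : IsConnected Ω)
    (Sg : Set (EuclideanSpace ℝ (Fin d))) (hSgcpt : IsCompact Sg) (hSgconn : IsConnected Sg)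
    (hSgsub : Sg ⊆ Ω)
    (η : ℝ) (hη : 0 < η)
    (hcover : IsCompact (closure (⋃ x ∈ Sg, Metric.ball x (4 * η))) ∧
      closure (⋃ x ∈ Sg, Metric.ball x (4 * η)) ⊆ Ω)
    (C₀ : ℝ) (hC₀ : 0 < C₀) :
    ∃ C : ℝ, 0 < C ∧
      ∀ x ∈ Sg, ∀ y ∈ Sg,
        ∀ u : EuclideanSpace ℝ (Fin d) → ℝ,
          ContinuousOn u Ω → (∀ z ∈ Ω, 0 ≤ u z) →
          (∀ z ∈ ⋃ w ∈ Sg, Metric.ball w (2 * η), C₀ * ∫ s in Metric.ball z η, u s ≤ u z) →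
          C * ∫ s in Metric.ball y (η / 4), u s ≤ ∫ s in Metric.ball x (η / 4), u s := by
  obtain ⟨hK, hKΩ⟩ := hcover
  set K := closure (⋃ x ∈ Sg, Metric.ball x (4 * η)) with hKdef
  have hballK : ∀ x ∈ Sg, ball x (4 * η) ⊆ K := fun x hx =>
    (subset_biUnion_of_mem (u := fun x => ball x (4 * η)) hx).trans subset_closure
  let X := {u : EuclideanSpace ℝ (Fin d) → ℝ // ContinuousOn u Ω ∧ (∀ z ∈ Ω, 0 ≤ u z) ∧
    (∀ z ∈ ⋃ w ∈ Sg, Metric.ball w (2 * η), C₀ * ∫ s in Metric.ball z η, u s ≤ u z)}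
  let v : ℝ := volume.real (ball (0 : EuclideanSpace ℝ (Fin d)) (η / 4))
  have hvx : ∀ x : EuclideanSpace ℝ (Fin d), volume.real (ball x (η / 4)) = v := by
    intro x
    simp only [v, Measure.real, Measure.addHaar_ball_center volume x]
  have hv : 0 < v := ENNReal.toReal_pos (measure_ball_pos _ _ (by positivity)).ne'
    measure_ball_lt_top.ne
  have hsmall : ∀ x ∈ Sg, ball x (η / 4) ⊆ K := fun x hx =>
    (ball_subset_ball (by linarith)).trans (hballK x hx)
  obtain ⟨C, hC, H⟩ := chain_aux Sg hSgcpt hSgconn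
    (fun (u : X) x => ∫ s in ball x (η / 4), u.1 s)
    (fun u x hx => setIntegral_nonneg measurableSet_ball
      fun z hz => u.2.2.1 z (hKΩ (hsmall x hx hz)))
    (C₀ * v) (η / 2) (by positivity) (by positivity) (by
      rintro x hx y hy hxy ⟨u, hu, hu0, huX⟩
      have hint : IntegrableOn u K := (hu.mono hKΩ).integrableOn_compact hK
      have key : ∀ z ∈ ball x (η / 4), C₀ * ∫ s in ball y (η / 4), u s ≤ u z := by
        intro z hz
        have hz' : dist z x < η / 4 := hz
        have hzK : ball z η ⊆ K :=
          (ball_subset_ball' (by linarith)).trans (hballK x hx)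
        refine le_trans (mul_le_mul_of_nonneg_left ?_ hC₀.le)
          (huX z (mem_biUnion hx (ball_subset_ball (by linarith) hz)))
        refine setIntegral_mono_set (hint.mono_set hzK) ?_ ?_
        · filter_upwards [ae_restrict_mem measurableSet_ball] with s hs
          exact hu0 s (hKΩ (hzK hs))
        · refine (ball_subset_ball' ?_).eventuallyLE
          have := dist_triangle y x z
          rw [dist_comm y x, dist_comm x z] at this
          linarith
      have := setIntegral_mono_on (μ := volume) (s := ball x (η / 4))
        (f := fun _ => C₀ * ∫ s in ball y (η / 4), u s) (g := u)
        (integrableOn_const measure_ball_lt_top.ne) (hint.mono_set (hsmall x hx))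
        measurableSet_ball key
      rw [setIntegral_const, hvx, smul_eq_mul] at this
      show C₀ * v * ∫ s in ball y (η / 4), u s ≤ ∫ s in ball x (η / 4), u s
      linarith)
  exact ⟨C, hC, fun x hx y hy u h1 h2 h3 => H x hx y hy ⟨u, h1, h2, h3⟩⟩
end

section
/- Let Ω ⊆ ℝ^d be a domain, Σ a connected compact set compactly contained in Ω, and C₀ > 0. Choose η > 0 such that ⋃_{x∈Σ} B(x,4η) is compactly contained in Ω, and define X̃ := {u ∈ C(Ω) : u ≥ 0 and u(y) ≥ C₀·∫_{B(y,η)} u(s) ds for all y ∈ ⋃_{x∈Σ} B(x,2η)}. Then there exist constants C > 0 (depending only on η, C₀, Σ) and N > 0 (depending only on η, Σ) such that for all x ∈ Σ and all u ∈ X̃: ∫_{B(x,η/4)} u(s) ds ≥ (C/N)·∫_Σ u(s) ds. -/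
open MeasureTheory Metric Set

/-- Lemma 3.2 (ii) (`h-lem-loc-esti3` (ii)): for a connected compact `Sg ⊂⊂ Ω` and
`η > 0` with `⋃_{x∈Sg} B(x,4η) ⊂⊂ Ω`, there are `C > 0` and `N > 0` such that every
`u ∈ X̃` satisfies `∫_{B(x,η/4)} u ≥ (C/N) ∫_{Sg} u` for all `x ∈ Sg`. -/
theorem stmt_10 {d : ℕ} (hd : 0 < d)
    (Ω : Set (EuclideanSpace ℝ (Fin d))) (hΩopen : IsOpen Ω) (hΩconn : IsConnected Ω)
    (Sg : Set (EuclideanSpace ℝ (Fin d))) (hSgcpt : IsCompact Sg) (hSgconn : IsConnected Sg)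
    (hSgsub : Sg ⊆ Ω)
    (η : ℝ) (hη : 0 < η)
    (hcover : IsCompact (closure (⋃ x ∈ Sg, Metric.ball x (4 * η))) ∧
      closure (⋃ x ∈ Sg, Metric.ball x (4 * η)) ⊆ Ω)
    (C₀ : ℝ) (hC₀ : 0 < C₀) :
    ∃ C : ℝ, ∃ N : ℝ, 0 < C ∧ 0 < N ∧
      ∀ x ∈ Sg,
        ∀ u : EuclideanSpace ℝ (Fin d) → ℝ,
          ContinuousOn u Ω → (∀ z ∈ Ω, 0 ≤ u z) →
          (∀ z ∈ ⋃ w ∈ Sg, Metric.ball w (2 * η), C₀ * ∫ s in Metric.ball z η, u s ≤ u z) →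
          (C / N) * ∫ s in Sg, u s ≤ ∫ s in Metric.ball x (η / 4), u s := by
  classical
  set K := closure (⋃ x ∈ Sg, Metric.ball x (4 * η)) with hK
  let X : Set (EuclideanSpace ℝ (Fin d) → ℝ) := {u | ContinuousOn u Ω ∧ (∀ z ∈ Ω, 0 ≤ u z) ∧
          (∀ z ∈ ⋃ w ∈ Sg, Metric.ball w (2 * η), C₀ * ∫ s in Metric.ball z η, u s ≤ u z)}
  have hint : ∀ u ∈ X, IntegrableOn u K := fun u hu =>
    (hu.1.mono hcover.2).integrableOn_compact hcover.1
  have hballK : ∀ x ∈ Sg, Metric.ball x (4 * η) ⊆ K := fun x hx =>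
    (subset_biUnion_of_mem (u := fun x => Metric.ball x (4 * η)) hx).trans subset_closure
  have hmono : ∀ u ∈ X, ∀ s t : Set (EuclideanSpace ℝ (Fin d)), s ⊆ t → t ⊆ K →
      MeasurableSet t → ∫ z in s, u z ≤ ∫ z in t, u z := by
    intro u hu s t hst htK ht
    refine setIntegral_mono_set ((hint u hu).mono_set htK) ?_ (Filter.Eventually.of_forall hst)
    filter_upwards [ae_restrict_mem ht] with z hz
    exact hu.2.1 z (hcover.2 (htK hz))
  have hnn : ∀ u ∈ X, ∀ t : Set (EuclideanSpace ℝ (Fin d)), t ⊆ K →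
      MeasurableSet t → 0 ≤ ∫ z in t, u z := by
    intro u hu t htK ht
    exact setIntegral_nonneg ht fun z hz => hu.2.1 z (hcover.2 (htK hz))
  have hsmall : ∀ x ∈ Sg, Metric.ball x (η / 4) ⊆ K := fun x hx =>
    (Metric.ball_subset_ball (by linarith)).trans (hballK x hx)
  obtain ⟨κ, hκ, hloc⟩ : ∃ κ : ℝ, 0 < κ ∧ ∀ x ∈ Sg, ∀ y ∈ Sg, dist x y < η / 2 → ∀ u ∈ X,
      κ * ∫ z in Metric.ball y (η / 4), u z ≤ ∫ z in Metric.ball x (η / 4), u z := by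
    refine ⟨C₀ * volume.real (Metric.ball (0 : EuclideanSpace ℝ (Fin d)) (η / 4)), ?_, ?_⟩
    · refine mul_pos hC₀ ?_
      exact ENNReal.toReal_pos (Metric.measure_ball_pos _ _ (by linarith)).ne'
        measure_ball_lt_top.ne
    · intro x hx y hy hxy u hu
      have h1 : ∀ z ∈ Metric.ball x (η / 4),
          C₀ * ∫ s in Metric.ball y (η / 4), u s ≤ u z := by
        intro z hz
        rw [Metric.mem_ball] at hz
        refine le_trans ?_ (hu.2.2 z (mem_biUnion hx (Metric.mem_ball.2 (by linarith))))
        refine mul_le_mul_of_nonneg_left ?_ hC₀.le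
        refine hmono u hu _ _ ?_ ?_ measurableSet_ball
        · apply Metric.ball_subset_ball'
          have := dist_triangle y x z
          rw [dist_comm y x, dist_comm x z] at this
          linarith
        · refine Subset.trans ?_ (hballK x hx)
          apply Metric.ball_subset_ball'
          linarith
      have h2 : volume.real (Metric.ball x (η / 4)) =
          volume.real (Metric.ball (0 : EuclideanSpace ℝ (Fin d)) (η / 4)) := by
        simp only [Measure.real]
        rw [Measure.addHaar_ball_center]
      rw [← h2]
      have h3 := setIntegral_mono_on (μ := volume) (s := Metric.ball x (η / 4))
        (f := fun _ => C₀ * ∫ s in Metric.ball y (η / 4), u s) (g := u)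
        (integrableOn_const measure_ball_lt_top.ne)
        ((hint u hu).mono_set (hsmall x hx)) measurableSet_ball h1
      rw [setIntegral_const, smul_eq_mul] at h3
      linarith
  have hR : ∀ x ∈ Sg, ∀ y ∈ Sg, ∃ c : ℝ, 0 < c ∧ ∀ u ∈ X,
      c * ∫ z in Metric.ball y (η / 4), u z ≤ ∫ z in Metric.ball x (η / 4), u z := by
    intro x hx y hy
    have := hSgconn.isPreconnected.induction₂' (fun x y => x ∈ Sg → y ∈ Sg → ∃ c : ℝ, 0 < c ∧ ∀ u ∈ X,
      c * ∫ z in Metric.ball y (η / 4), u z ≤ ∫ z in Metric.ball x (η / 4), u z) ?_ ?_ hx hy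
    · exact this hx hy
    · intro x hx
      filter_upwards [mem_nhdsWithin_of_mem_nhds (Metric.ball_mem_nhds x (half_pos hη))] with y hy
      exact ⟨fun hx hy' => ⟨κ, hκ, hloc x hx y hy' (by rw [dist_comm]; exact hy)⟩,
        fun hy' hx => ⟨κ, hκ, hloc y hy' x hx hy⟩⟩
    · intro x y z hx hy hz h1 h2 _ _
      obtain ⟨c, hc, h1⟩ := h1 hx hy
      obtain ⟨c', hc', h2⟩ := h2 hy hz
      refine ⟨c * c', mul_pos hc hc', fun u hu => ?_⟩
      have := mul_le_mul_of_nonneg_left (h2 u hu) hc.le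
      have := h1 u hu
      linarith
  obtain ⟨x0, hx0⟩ := hSgconn.nonempty
  obtain ⟨a, ha, hA⟩ : ∃ a : ℝ, 0 < a ∧ ∀ x ∈ Sg, ∀ u ∈ X,
      a * ∫ z in Metric.ball x0 (η / 4), u z ≤ ∫ z in Metric.ball x (η / 4), u z := by
    suffices H : ∃ a : ℝ, 0 < a ∧ ∀ x ∈ Sg, x ∈ Sg → ∀ u ∈ X,
        a * ∫ z in Metric.ball x0 (η / 4), u z ≤ ∫ z in Metric.ball x (η / 4), u z by
      obtain ⟨a, ha, H⟩ := H
      exact ⟨a, ha, fun x hx => H x hx hx⟩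
    refine hSgcpt.induction_on (p := fun s => ∃ a : ℝ, 0 < a ∧ ∀ x ∈ s, x ∈ Sg → ∀ u ∈ X,
        a * ∫ z in Metric.ball x0 (η / 4), u z ≤ ∫ z in Metric.ball x (η / 4), u z) ?_ ?_ ?_ ?_
    · exact ⟨1, one_pos, by simp⟩
    · rintro s t hst ⟨a, ha, h⟩
      exact ⟨a, ha, fun x hx => h x (hst hx)⟩
    · rintro s t ⟨a, ha, h⟩ ⟨b, hb, h'⟩
      refine ⟨min a b, lt_min ha hb, ?_⟩
      intro x hx hxS u hu
      have h0 := hnn u hu _ (hsmall x0 hx0) measurableSet_ball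
      rcases hx with hx | hx
      · exact (mul_le_mul_of_nonneg_right (min_le_left _ _) h0).trans (h x hx hxS u hu)
      · exact (mul_le_mul_of_nonneg_right (min_le_right _ _) h0).trans (h' x hx hxS u hu)
    · intro x hx
      obtain ⟨c, hc, h⟩ := hR x hx x0 hx0
      refine ⟨_, mem_nhdsWithin_of_mem_nhds (Metric.ball_mem_nhds x (half_pos hη)), κ * c,
        mul_pos hκ hc, ?_⟩
      intro y hy hyS u hu
      have h1 := hloc y hyS x hx hy u hu
      have := mul_le_mul_of_nonneg_left (h u hu) hκ.le
      linarith
  obtain ⟨M, hM, t, hSt, hmt, htK, hB⟩ : ∃ M : ℝ, 0 < M ∧ ∃ t, Sg ⊆ t ∧ MeasurableSet t ∧ t ⊆ K ∧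
      ∀ u ∈ X, ∫ z in t, u z ≤ M * ∫ z in Metric.ball x0 (η / 4), u z := by
    refine hSgcpt.induction_on (p := fun s => ∃ M : ℝ, 0 < M ∧ ∃ t, s ⊆ t ∧ MeasurableSet t ∧
      t ⊆ K ∧ ∀ u ∈ X, ∫ z in t, u z ≤ M * ∫ z in Metric.ball x0 (η / 4), u z) ?_ ?_ ?_ ?_
    · refine ⟨1, one_pos, ∅, Subset.rfl, MeasurableSet.empty, empty_subset _, fun u hu => ?_⟩
      have h0 := hnn u hu _ (hsmall x0 hx0) measurableSet_ball
      simpa using h0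
    · rintro s s' hst ⟨M, hM, t, h, h'⟩
      exact ⟨M, hM, t, hst.trans h, h'⟩
    · rintro s s' ⟨M, hM, t, h, hm, hK1, h1⟩ ⟨M', hM', t', h', hm', hK2, h2⟩
      refine ⟨M + M', add_pos hM hM', t ∪ t', union_subset_union h h', hm.union hm',
        union_subset hK1 hK2, fun u hu => ?_⟩
      have e : ∫ z in t ∪ t', u z = (∫ z in t, u z) + ∫ z in t' \ t, u z := by
        rw [← union_sdiff_self]
        exact setIntegral_union disjoint_sdiff_right (hm'.diff hm)
          ((hint u hu).mono_set hK1) ((hint u hu).mono_set (sdiff_subset.trans hK2))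
      have e1 := hmono u hu (t' \ t) t' sdiff_subset hK2 hm'
      have e2 := h1 u hu
      have e3 := h2 u hu
      rw [e, add_mul]
      linarith
    · intro x hx
      obtain ⟨c, hc, h⟩ := hR x0 hx0 x hx
      refine ⟨Metric.ball x (η / 4), mem_nhdsWithin_of_mem_nhds
        (Metric.ball_mem_nhds x (by linarith)), c⁻¹, inv_pos.2 hc, _, Subset.rfl,
        measurableSet_ball, hsmall x hx, fun u hu => ?_⟩
      rw [le_inv_mul_iff₀ hc]
      exact h u hu
  refine ⟨a, M, ha, hM, fun x hx u h1 h2 h3 => ?_⟩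
  have hu : u ∈ X := ⟨h1, h2, h3⟩
  refine le_trans ?_ (hA x hx u hu)
  rw [div_mul_eq_mul_div, mul_div_assoc]
  refine mul_le_mul_of_nonneg_left ?_ ha.le
  rw [div_le_iff₀ hM, mul_comm]
  exact (hmono u hu _ _ hSt htK hmt).trans (hB u hu)
end
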